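/- Let (X,T) be a minimal dynamical system. If (X,T) is spatio-temporally chaotic, then it is thickly sensitive. -/

import Mathlib

open Filter Topology Set Metric

section Defs

variable {X : Type*}

/-- A set is "opene" if it is open and nonempty. -/
def Opene [TopologicalSpace X] (U : Set X) : Prop := IsOpen U ∧ U.Nonempty

/-- `N_T(U,V) = {n ∈ ℕ : U ∩ T⁻ⁿV ≠ ∅}`. -/
def NTset (T : X → X) (U V : Set X) : Set ℕ := {n | (U ∩ T^[n] ⁻¹' V).Nonempty}

/-- `N_T(x,G) = {n ∈ ℕ : Tⁿx ∈ G}`. -/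
def NTpt (T : X → X) (x : X) (G : Set X) : Set ℕ := {n | T^[n] x ∈ G}

/-- `ω_{N_T}(x)`. -/
def omegaNT [TopologicalSpace X] (T : X → X) (x : X) : Set X :=
  {z | ∀ G : Set X, IsOpen G → z ∈ G → ∀ U V : Set X, Opene U → Opene V →
    (NTpt T x G ∩ NTset T U V).Nonempty}

/-- The ω-limit set `ω_T(x)`. -/
def omegaT [TopologicalSpace X] (T : X → X) (x : X) : Set X :=
  {z | ∀ G : Set X, IsOpen G → z ∈ G → (NTpt T x G).Infinite}

/-- Transitive compact system. -/
def TransCompact [TopologicalSpace X] (T : X → X) : Prop :=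
  ∀ x : X, (omegaNT T x).Nonempty

/-- Topologically transitive system. -/
def TopTransitive [TopologicalSpace X] (T : X → X) : Prop :=
  ∀ U V : Set X, Opene U → Opene V → (NTset T U V).Nonempty

/-- Weakly mixing: the product system `(X×X, T×T)` is topologically transitive. -/
def WeaklyMixing [TopologicalSpace X] (T : X → X) : Prop :=
  TopTransitive (fun p : X × X => (T p.1, T p.2))

/-- Totally transitive: `(X, T^k)` is transitive for every `k ≥ 1`. -/
def TotallyTransitive [TopologicalSpace X] (T : X → X) : Prop :=
  ∀ k : ℕ, 1 ≤ k → TopTransitive (T^[k])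

/-- Minimal system: every point has dense orbit. -/
def MinimalSystem [TopologicalSpace X] (T : X → X) : Prop :=
  ∀ x : X, Dense (Set.range fun n : ℕ => T^[n] x)

/-- A minimal subset: nonempty, closed, `T M = M`, with no proper nonempty closed invariant subset. -/
def IsMinimalSubset [TopologicalSpace X] (T : X → X) (M : Set X) : Prop :=
  M.Nonempty ∧ IsClosed M ∧ T '' M = M ∧
    ∀ M' : Set X, M' ⊆ M → M'.Nonempty → IsClosed M' → T '' M' = M' → M' = M

/-- A minimal point: one that lies in some minimal subset. -/
def IsMinimalPoint [TopologicalSpace X] (T : X → X) (x : X) : Prop :=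
  ∃ M : Set X, IsMinimalSubset T M ∧ x ∈ M

/-- An M-system: transitive with a dense set of minimal points. -/
def MSystem [TopologicalSpace X] (T : X → X) : Prop :=
  TopTransitive T ∧ Dense {x : X | IsMinimalPoint T x}

/-- Thick subset of ℕ. -/
def ThickSet (S : Set ℕ) : Prop := ∀ N : ℕ, ∃ m : ℕ, ∀ i ≤ N, m + i ∈ S

/-- Syndetic subset of ℕ. -/
def SyndeticSet (S : Set ℕ) : Prop := ∃ N : ℕ, ∀ i : ℕ, ∃ j ≤ N, i + j ∈ S

/-- Thickly syndetic subset of ℕ. -/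
def ThicklySyndeticSet (S : Set ℕ) : Prop :=
  ∀ N : ℕ, SyndeticSet {m : ℕ | ∀ i ≤ N, m + i ∈ S}

/-- `S_T(U,δ)`. -/
def STset [MetricSpace X] (T : X → X) (U : Set X) (δ : ℝ) : Set ℕ :=
  {n | ∃ x ∈ U, ∃ y ∈ U, δ < dist (T^[n] x) (T^[n] y)}

/-- Thickly sensitive system. -/
def ThicklySensitive [MetricSpace X] (T : X → X) : Prop :=
  ∃ δ : ℝ, 0 < δ ∧ ∀ U : Set X, Opene U → ThickSet (STset T U δ)

/-- Thickly syndetically sensitive system. -/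
def ThicklySyndeticallySensitive [MetricSpace X] (T : X → X) : Prop :=
  ∃ δ : ℝ, 0 < δ ∧ ∀ U : Set X, Opene U → ThicklySyndeticSet (STset T U δ)

/-- Multi-sensitive system. -/
def MultiSensitive [MetricSpace X] (T : X → X) : Prop :=
  ∃ δ : ℝ, 0 < δ ∧ ∀ (k : ℕ) (U : Fin (k + 1) → Set X), (∀ i, Opene (U i)) →
    (⋂ i, STset T (U i) δ).Nonempty

/-- Thickly syndetically transitive system. -/
def ThicklySyndeticallyTransitive [TopologicalSpace X] (T : X → X) : Prop :=
  ∀ U V : Set X, Opene U → Opene V → ThicklySyndeticSet (NTset T U V)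

/-- A proximal pair: `liminf d(Tⁿx,Tⁿy) = 0`. -/
def ProximalPair [MetricSpace X] (T : X → X) (x y : X) : Prop :=
  liminf (fun n : ℕ => dist (T^[n] x) (T^[n] y)) atTop = 0

/-- A proximal system: every pair of points is proximal. -/
def ProximalSystem [MetricSpace X] (T : X → X) : Prop :=
  ∀ x y : X, ProximalPair T x y

/-- The proximal cell of `x`. -/
def ProxCell [MetricSpace X] (T : X → X) (x : X) : Set X :=
  {y | ProximalPair T x y}

/-- Li-Yorke sensitivity. -/
def LiYorkeSensitive [MetricSpace X] (T : X → X) : Prop :=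
  ∃ δ : ℝ, 0 < δ ∧ ∀ x : X, ∀ U ∈ 𝓝 x, ∃ y ∈ U,
    liminf (fun n : ℕ => dist (T^[n] x) (T^[n] y)) atTop = 0 ∧
    δ < limsup (fun n : ℕ => dist (T^[n] x) (T^[n] y)) atTop

/-- Spatio-temporally chaotic system. -/
def SpatioTemporallyChaotic [MetricSpace X] (T : X → X) : Prop :=
  ∀ x : X, ∀ U ∈ 𝓝 x, ∃ y ∈ U,
    liminf (fun n : ℕ => dist (T^[n] x) (T^[n] y)) atTop = 0 ∧
    0 < limsup (fun n : ℕ => dist (T^[n] x) (T^[n] y)) atTop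

/-- A distal point: not proximal to any other point of its orbit closure. -/
def IsDistalPoint [MetricSpace X] (T : X → X) (x : X) : Prop :=
  ∀ y ∈ closure (Set.range fun n : ℕ => T^[n] x), y ≠ x →
    0 < liminf (fun n : ℕ => dist (T^[n] x) (T^[n] y)) atTop

/-- The Lyapunov number `𝕃_r`. -/
noncomputable def LyapR [MetricSpace X] (T : X → X) : ℝ :=
  sSup {δ : ℝ | 0 < δ ∧ ∀ x : X, ∀ U : Set X, IsOpen U → x ∈ U →
    ∃ y ∈ U, ∃ n : ℕ, δ < dist (T^[n] x) (T^[n] y)}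

/-- The Lyapunov number `𝕃̄_r`. -/
noncomputable def LyapRbar [MetricSpace X] (T : X → X) : ℝ :=
  sSup {δ : ℝ | 0 < δ ∧ ∀ x : X, ∀ U : Set X, IsOpen U → x ∈ U →
    ∃ y ∈ U, δ < limsup (fun n : ℕ => dist (T^[n] x) (T^[n] y)) atTop}

/-- `min_{1≤i≤k} d(Tⁿ xᵢ, Tⁿ yᵢ)`. -/
noncomputable def minDist [MetricSpace X] (T : X → X) {k : ℕ}
    (x y : Fin (k + 1) → X) (n : ℕ) : ℝ :=
  Finset.univ.inf' Finset.univ_nonempty (fun i => dist (T^[n] (x i)) (T^[n] (y i)))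

/-- The Lyapunov number `𝕃_{m,r}`. -/
noncomputable def LyapMR [MetricSpace X] (T : X → X) : ℝ :=
  sSup {δ : ℝ | 0 < δ ∧ ∀ (k : ℕ) (x : Fin (k + 1) → X) (U : Fin (k + 1) → Set X),
    (∀ i, IsOpen (U i) ∧ x i ∈ U i) →
    ∃ y : Fin (k + 1) → X, (∀ i, y i ∈ U i) ∧ ∃ n : ℕ, δ < minDist T x y n}

/-- The Lyapunov number `𝕃̄_{m,r}`. -/
noncomputable def LyapMRbar [MetricSpace X] (T : X → X) : ℝ :=
  sSup {δ : ℝ | 0 < δ ∧ ∀ (k : ℕ) (x : Fin (k + 1) → X) (U : Fin (k + 1) → Set X),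
    (∀ i, IsOpen (U i) ∧ x i ∈ U i) →
    ∃ y : Fin (k + 1) → X, (∀ i, y i ∈ U i) ∧
      δ < limsup (fun n : ℕ => minDist T x y n) atTop}

/-- The Lyapunov number `𝕃_{m,d}`. -/
noncomputable def LyapMD [MetricSpace X] (T : X → X) : ℝ :=
  sSup {δ : ℝ | 0 < δ ∧ ∀ (k : ℕ) (U : Fin (k + 1) → Set X), (∀ i, Opene (U i)) →
    ∃ x y : Fin (k + 1) → X, (∀ i, x i ∈ U i ∧ y i ∈ U i) ∧ ∃ n : ℕ, δ < minDist T x y n}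

/-- The Lyapunov number `𝕃̄_{m,d}`. -/
noncomputable def LyapMDbar [MetricSpace X] (T : X → X) : ℝ :=
  sSup {δ : ℝ | 0 < δ ∧ ∀ (k : ℕ) (U : Fin (k + 1) → Set X), (∀ i, Opene (U i)) →
    ∃ x y : Fin (k + 1) → X, (∀ i, x i ∈ U i ∧ y i ∈ U i) ∧
      δ < limsup (fun n : ℕ => minDist T x y n) atTop}

/-- `(k,T,ε)`-separated set with respect to the sequence `ns` (with `ns 0 = 0` by convention). -/
def IsSepSet [MetricSpace X] (T : X → X) (ns : ℕ → ℕ) (k : ℕ) (ε : ℝ) (E : Set X) : Prop :=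
  ∀ x ∈ E, ∀ y ∈ E, x ≠ y → ∃ j < k, ε < dist (T^[ns j] x) (T^[ns j] y)

/-- `sep(k,T,ε)`: maximal cardinality of a `(k,T,ε)`-separated set. -/
noncomputable def sepNum [MetricSpace X] (T : X → X) (ns : ℕ → ℕ) (k : ℕ) (ε : ℝ) : ℕ :=
  sSup {r : ℕ | ∃ E : Finset X, IsSepSet T ns k ε ↑E ∧ E.card = r}

/-- Topological sequence entropy along `ns`:
`h_N(T) = lim_{ε→0} limsup_{k→∞} (1/k) log sep(k,T,ε)` (the limit as `ε → 0⁺` of the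
nonincreasing-in-`ε` quantity, i.e. the supremum over `ε > 0`). -/
noncomputable def seqEntropy [MetricSpace X] (T : X → X) (ns : ℕ → ℕ) : EReal :=
  ⨆ (ε : ℝ) (_ : 0 < ε),
    limsup (fun k : ℕ => ((Real.log (sepNum T ns k ε) / k : ℝ) : EReal)) atTop

end Defs

section Helpers

variable {X : Type*} [MetricSpace X]

/-- The orbits of `x` and `y` come arbitrarily close arbitrarily late. -/
def OftenClose (T : X → X) (x y : X) : Prop :=
  ∀ ε > 0, ∀ m : ℕ, ∃ n ≥ m, dist (T^[n] x) (T^[n] y) < ε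

lemma OftenClose.of_iterate {T : X → X} {x y : X} {k : ℕ}
    (h : OftenClose T (T^[k] x) (T^[k] y)) : OftenClose T x y := by
  intro ε hε m
  obtain ⟨n, hn, hd⟩ := h ε hε m
  refine ⟨n + k, by omega, ?_⟩
  rwa [Function.iterate_add_apply, Function.iterate_add_apply]

lemma oftenClose_of_liminf_eq_zero {T : X → X} [CompactSpace X] {x y : X}
    (h : liminf (fun n : ℕ => dist (T^[n] x) (T^[n] y)) atTop = 0) : OftenClose T x y := by
  intro ε hε m
  have hcob : IsCoboundedUnder (· ≥ ·) atTop (fun n : ℕ => dist (T^[n] x) (T^[n] y)) := by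
    refine IsBoundedUnder.isCoboundedUnder_ge
      (isBoundedUnder_of ⟨diam (univ : Set X), fun n => ?_⟩)
    exact dist_le_diam_of_mem isCompact_univ.isBounded (mem_univ _) (mem_univ _)
  have hfr := frequently_lt_of_liminf_lt (b := ε) hcob (by rw [h]; exact hε)
  exact frequently_atTop.mp hfr m

lemma exists_dist_iterate_lt [CompactSpace X] {T : X → X} (hT : Continuous T) (K : ℕ) {ε : ℝ}
    (hε : 0 < ε) :
    ∃ η > 0, ∀ x y : X, dist x y < η → ∀ j ≤ K, dist (T^[j] x) (T^[j] y) < ε := by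
  induction K with
  | zero =>
    refine ⟨ε, hε, fun x y h j hj => ?_⟩
    obtain rfl : j = 0 := by omega
    exact h
  | succ K ih =>
    obtain ⟨η, hη, h⟩ := ih
    have huc : UniformContinuous (T^[K + 1]) :=
      CompactSpace.uniformContinuous_of_continuous (hT.iterate _)
    obtain ⟨η', hη', h'⟩ := Metric.uniformContinuous_iff.mp huc ε hε
    refine ⟨min η η', lt_min hη hη', fun x y hxy j hj => ?_⟩
    rcases Nat.lt_or_ge K j with hj' | hj'
    · obtain rfl : j = K + 1 := by omega
      exact h' (hxy.trans_le (min_le_right _ _))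
    · exact h x y (hxy.trans_le (min_le_left _ _)) j hj'

lemma MinimalSystem.exists_iterate_mem {T : X → X} (hmin : MinimalSystem T) {U : Set X}
    (hU : Opene U) (x : X) : ∃ n, T^[n] x ∈ U := by
  obtain ⟨_, hy, n, rfl⟩ := (hmin x).inter_open_nonempty U hU.1 hU.2
  exact ⟨n, hy⟩

lemma MinimalSystem.exists_iterate_mem_le [CompactSpace X] {T : X → X} (hT : Continuous T)
    (hmin : MinimalSystem T) {U : Set X} (hU : Opene U) :
    ∃ M, ∀ x, ∃ n ≤ M, T^[n] x ∈ U := by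
  obtain ⟨t, ht⟩ := isCompact_univ.elim_finite_subcover (fun n : ℕ => T^[n] ⁻¹' U)
    (fun n => hU.1.preimage (hT.iterate n))
    (fun x _ => mem_iUnion.mpr (hmin.exists_iterate_mem hU x))
  refine ⟨t.sup id, fun x => ?_⟩
  obtain ⟨n, hn, hx⟩ := mem_iUnion₂.mp (ht (mem_univ x))
  exact ⟨n, Finset.le_sup (f := id) hn, hx⟩

/-- A minimal map on a compact space is semi-open. -/
lemma MinimalSystem.exists_opene_subset_image [CompactSpace X] {T : X → X} (hT : Continuous T)
    (hTs : Function.Surjective T) (hmin : MinimalSystem T) {W : Set X} (hW : Opene W) :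
    ∃ V, Opene V ∧ V ⊆ T '' W := by
  have hclosed : IsClosed (T '' Wᶜ) := (hW.1.isClosed_compl.isCompact.image hT).isClosed
  by_cases hsurj : T '' Wᶜ = univ
  · exfalso
    obtain ⟨M, hM⟩ := hmin.exists_iterate_mem_le hT hW
    have hs : ∀ x, ∃ y, y ∈ Wᶜ ∧ T y = x := fun x => by
      have : x ∈ T '' Wᶜ := hsurj ▸ mem_univ x
      exact this
    choose s hsW hTs using hs
    have hiter : ∀ n x, T^[n] (s^[n] x) = x := fun n => Function.LeftInverse.iterate hTs n
    obtain ⟨x, -⟩ := hW.2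
    obtain ⟨n, hn, hx⟩ := hM (s^[M + 1] x)
    obtain ⟨k, rfl⟩ := Nat.exists_eq_add_of_le hn
    rw [show n + k + 1 = n + (k + 1) by omega, Function.iterate_add_apply, hiter,
      Function.iterate_succ_apply'] at hx
    exact hsW _ hx
  · refine ⟨(T '' Wᶜ)ᶜ, ⟨hclosed.isOpen_compl, nonempty_compl.mpr hsurj⟩, fun x hx => ?_⟩
    by_contra hxW
    obtain ⟨y, hy⟩ := hTs x
    by_cases hyW : y ∈ W
    · exact hxW ⟨y, hyW, hy⟩
    · exact hx ⟨y, hyW, hy⟩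

lemma MinimalSystem.exists_opene_subset_image_iterate [CompactSpace X] {T : X → X}
    (hT : Continuous T) (hTs : Function.Surjective T) (hmin : MinimalSystem T) {W : Set X}
    (hW : Opene W) (k : ℕ) :
    ∃ V, Opene V ∧ V ⊆ T^[k] '' W := by
  induction k with
  | zero => exact ⟨W, hW, by simp⟩
  | succ k ih =>
    obtain ⟨V, hV, hVW⟩ := ih
    obtain ⟨V', hV', hVV'⟩ := hmin.exists_opene_subset_image hT hTs hV
    refine ⟨V', hV', hVV'.trans ?_⟩
    rw [Function.iterate_succ', image_comp]
    exact image_mono hVW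

/-- In a minimal spatio-temporally chaotic system, separated proximal pairs start from a dense
set of points, uniformly in the separation time. -/
lemma SpatioTemporallyChaotic.exists_oftenClose [CompactSpace X] [Nonempty X] {T : X → X}
    (hT : Continuous T) (hTs : Function.Surjective T) (hmin : MinimalSystem T)
    (hstc : SpatioTemporallyChaotic T) :
    ∃ δ > 0, ∀ i : ℕ, ∀ W : Set X, Opene W →
      ∃ w ∈ W, ∃ z, OftenClose T w z ∧ δ < dist (T^[i] w) (T^[i] z) := by
  let E : ℕ → Set X := fun j => {x | ∃ y, OftenClose T x y ∧ 1 / ((j : ℝ) + 1) < dist x y}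
  have hE : ⋃ j, closure (E j) = univ := by
    refine eq_univ_of_forall fun x => ?_
    obtain ⟨y, -, hinf, hsup⟩ := hstc x univ univ_mem
    have hxy : x ≠ y := by
      rintro rfl
      simp at hsup
    obtain ⟨j, hj⟩ := exists_nat_one_div_lt (dist_pos.mpr hxy)
    exact mem_iUnion.mpr ⟨j, subset_closure ⟨y, oftenClose_of_liminf_eq_zero hinf, hj⟩⟩
  obtain ⟨j, hj⟩ := nonempty_interior_of_iUnion_of_closed (fun j => isClosed_closure) hE
  have hO : Opene (interior (closure (E j))) := ⟨isOpen_interior, hj⟩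
  obtain ⟨K, hK⟩ := hmin.exists_iterate_mem_le hT hO
  obtain ⟨δ, hδ, hmod⟩ := exists_dist_iterate_lt hT K (Nat.one_div_pos_of_nat (α := ℝ) (n := j))
  refine ⟨δ / 2, half_pos hδ, fun i W hW => ?_⟩
  obtain ⟨w₀, hw₀⟩ := hW.2
  obtain ⟨k, hk, hkO⟩ := hK (T^[i] w₀)
  rw [← Function.iterate_add_apply] at hkO
  obtain ⟨V, hV, hVW⟩ := hmin.exists_opene_subset_image_iterate hT hTs
    (W := W ∩ T^[k + i] ⁻¹' interior (closure (E j)))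
    ⟨hW.1.inter (isOpen_interior.preimage (hT.iterate _)), w₀, hw₀, hkO⟩ (k + i)
  obtain ⟨v₀, hv₀⟩ := hV.2
  have hv₀E : v₀ ∈ closure (E j) := by
    obtain ⟨w, hw, rfl⟩ := hVW hv₀
    exact interior_subset hw.2
  obtain ⟨v, hvV, y, hvy, hd⟩ := mem_closure_iff.mp hv₀E V hV.1 hv₀
  obtain ⟨w, hw, rfl⟩ := hVW hvV
  obtain ⟨z, rfl⟩ := (hTs.iterate (k + i)) y
  refine ⟨w, hw.1, z, hvy.of_iterate, ?_⟩
  by_contra! hle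
  have := hmod (T^[i] w) (T^[i] z) (by linarith) k hk
  rw [← Function.iterate_add_apply, ← Function.iterate_add_apply] at this
  exact lt_asymm hd this

/-- A minimal system that is not thickly sensitive is syndetically equicontinuous. -/
lemma MinimalSystem.exists_syndetic_dist_le [CompactSpace X] {T : X → X} (hT : Continuous T)
    (hmin : MinimalSystem T) (hns : ¬ ThicklySensitive T) {ε : ℝ} (hε : 0 < ε) :
    ∃ η > 0, ∃ L : ℕ, ∀ x : X, ∀ m : ℕ, ∃ i ≤ L, ∀ y ∈ ball x η, ∀ y' ∈ ball x η,
      dist (T^[m + i] y) (T^[m + i] y') ≤ ε := by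
  simp only [ThicklySensitive, ThickSet, STset, mem_ofPred_eq] at hns
  push Not at hns
  obtain ⟨U, hU, N, hN⟩ := hns ε hε
  obtain ⟨M, hM⟩ := hmin.exists_iterate_mem_le hT hU
  obtain ⟨η, hη, hleb⟩ := lebesgue_number_lemma_of_metric (s := (univ : Set X))
    (c := fun n : Fin (M + 1) => T^[n] ⁻¹' U) isCompact_univ
    (fun n => hU.1.preimage (hT.iterate _))
    (fun x _ => by
      obtain ⟨n, hn, hx⟩ := hM x
      exact mem_iUnion.mpr ⟨⟨n, by omega⟩, hx⟩)
  refine ⟨η, hη, M + N, fun x m => ?_⟩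
  obtain ⟨n, hn⟩ := hleb x (mem_univ x)
  obtain ⟨i, hi, hdist⟩ := hN m
  refine ⟨i + n, by omega, fun y hy y' hy' => ?_⟩
  rw [← add_assoc, Function.iterate_add_apply, Function.iterate_add_apply T (m + i)]
  exact hdist _ (hn hy) _ (hn hy')

/-- Without thick sensitivity, separated proximal pairs with a common first point can be
collapsed simultaneously. -/
lemma exists_simultaneously_close [CompactSpace X] [Nonempty X] {T : X → X} (hT : Continuous T)
    (hmin : MinimalSystem T) (hns : ¬ ThicklySensitive T) {δ : ℝ}
    (hδ : ∀ i : ℕ, ∀ W : Set X, Opene W →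
      ∃ w ∈ W, ∃ z, OftenClose T w z ∧ δ < dist (T^[i] w) (T^[i] z)) (r : ℕ) :
    ∀ ε > 0, ∃ w : X, ∃ z : ℕ → X, ∃ Q : ℕ, ∀ i < r,
      δ < dist (T^[i] w) (T^[i] (z i)) ∧ dist (T^[Q] w) (T^[Q] (z i)) < ε := by
  induction r with
  | zero => exact fun _ _ => ⟨Classical.arbitrary X, fun _ => Classical.arbitrary X, 0, by simp⟩
  | succ r ih =>
    intro ε hε
    obtain ⟨η, hη, L, hL⟩ := hmin.exists_syndetic_dist_le hT hns (half_pos hε)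
    obtain ⟨w₀, z, Q, hz⟩ := ih η hη
    obtain ⟨ε', hε', hmod⟩ := exists_dist_iterate_lt hT L hε
    have hWopen : IsOpen ({w | ∀ i ∈ Finset.range r, δ < dist (T^[i] w) (T^[i] (z i))} ∩
        T^[Q] ⁻¹' ball (T^[Q] w₀) η) := by
      refine IsOpen.inter ?_ (isOpen_ball.preimage (hT.iterate _))
      simp only [ofPred_forall]
      exact isOpen_biInter_finset fun i _ =>
        isOpen_lt continuous_const ((hT.iterate _).dist continuous_const)
    obtain ⟨w, ⟨hw, hwB⟩, y, hwy, hd⟩ := hδ r _ ⟨hWopen, w₀,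
      fun i hi => (hz i (Finset.mem_range.mp hi)).1, mem_ball_self hη⟩
    obtain ⟨q, hq, hclose⟩ := hwy ε' hε' Q
    obtain ⟨k, rfl⟩ := Nat.exists_eq_add_of_le hq
    obtain ⟨i₀, hi₀, hsmall⟩ := hL (T^[Q] w₀) k
    refine ⟨w, Function.update z r y, k + i₀ + Q, fun i hi => ?_⟩
    rcases Nat.lt_succ_iff_lt_or_eq.mp hi with hi | rfl
    · rw [Function.update_of_ne hi.ne]
      refine ⟨hw i (Finset.mem_range.mpr hi), ?_⟩
      rw [Function.iterate_add_apply, Function.iterate_add_apply T (k + i₀)]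
      refine (hsmall _ hwB _ ?_).trans_lt (half_lt_self hε)
      rw [mem_ball, dist_comm]
      exact (hz i hi).2
    · rw [Function.update_self]
      refine ⟨hd, ?_⟩
      have := hmod _ _ hclose i₀ hi₀
      rwa [← Function.iterate_add_apply, ← Function.iterate_add_apply,
        show i₀ + (Q + k) = k + i₀ + Q by omega] at this

/-- Product recurrence: points separated at time `i` whose orbits meet `U` at a common time yield
times at which the image of `U` is large. -/
lemma MinimalSystem.exists_mem_STset {T : X → X} (hT : Continuous T) (hmin : MinimalSystem T)
    {U : Set X} (hU : IsOpen U) {δ : ℝ} {N Q : ℕ} {w : X} {z : ℕ → X}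
    (hwU : T^[Q] w ∈ U) (hzU : ∀ i ≤ N, T^[Q] (z i) ∈ U)
    (hd : ∀ i ≤ N, δ < dist (T^[i] w) (T^[i] (z i))) :
    ∃ m, ∀ i ≤ N, m + i ∈ STset T U δ := by
  have hwopen : IsOpen ({v | ∀ i ∈ Finset.range (N + 1), δ < dist (T^[i] v) (T^[i] (z i))} ∩
      T^[Q] ⁻¹' U) := by
    refine IsOpen.inter ?_ (hU.preimage (hT.iterate _))
    simp only [ofPred_forall]
    exact isOpen_biInter_finset fun i _ =>
      isOpen_lt continuous_const ((hT.iterate _).dist continuous_const)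
  obtain ⟨a, ha, haU⟩ := hmin.exists_iterate_mem
    ⟨hwopen, w, fun i hi => hd i (Nat.lt_succ_iff.mp (Finset.mem_range.mp hi)), hwU⟩ w
  have hb : ∀ i, ∃ b, i ≤ N →
      δ < dist (T^[i] (T^[a] w)) (T^[i] (T^[b] w)) ∧ T^[Q] (T^[b] w) ∈ U := by
    intro i
    by_cases hi : i ≤ N
    · obtain ⟨b, hb⟩ := hmin.exists_iterate_mem
        (U := {v | δ < dist (T^[i] (T^[a] w)) (T^[i] v)} ∩ T^[Q] ⁻¹' U)
        ⟨(isOpen_lt continuous_const (continuous_const.dist (hT.iterate _))).inter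
          (hU.preimage (hT.iterate _)),
          z i, ha i (Finset.mem_range.mpr (Nat.lt_succ_iff.mpr hi)), hzU i hi⟩ w
      exact ⟨b, fun _ => hb⟩
    · exact ⟨0, fun h => absurd h hi⟩
  choose b hb using hb
  have hvopen : IsOpen {v | ∀ i ∈ Finset.range (N + 1),
      δ < dist (T^[i] (T^[a] v)) (T^[i] (T^[b i] v))} := by
    simp only [ofPred_forall]
    exact isOpen_biInter_finset fun i _ => isOpen_lt continuous_const
      (((hT.iterate _).comp (hT.iterate _)).dist ((hT.iterate _).comp (hT.iterate _)))
  obtain ⟨m, hm⟩ := hmin.exists_iterate_mem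
    ⟨hvopen, w, fun i hi => (hb i (Nat.lt_succ_iff.mp (Finset.mem_range.mp hi))).1⟩ (T^[Q] w)
  refine ⟨m, fun i hi => ⟨_, haU, _, (hb i hi).2, ?_⟩⟩
  have := hm i (Finset.mem_range.mpr (Nat.lt_succ_iff.mpr hi))
  simp only [← Function.iterate_add_apply] at this ⊢
  rwa [show m + i + (Q + a) = i + (a + (m + Q)) by omega,
    show m + i + (Q + b i) = i + (b i + (m + Q)) by omega]

end Helpers

/-- A minimal spatio-temporally chaotic system is thickly sensitive. -/
theorem stmt11 {X : Type*} [MetricSpace X] [CompactSpace X] [Nontrivial X]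
    (hperf : ∀ x : X, (𝓝[≠] x).NeBot)
    {T : X → X} (hTc : Continuous T) (hTs : Function.Surjective T)
    (hmin : MinimalSystem T) (hstc : SpatioTemporallyChaotic T) :
    ThicklySensitive T := by
  by_contra hns
  obtain ⟨δ, hδ, hpair⟩ := hstc.exists_oftenClose hTc hTs hmin
  refine hns ⟨δ, hδ, fun U hU N => ?_⟩
  obtain ⟨u, hu⟩ := hU.2
  obtain ⟨ρ, hρ, hball⟩ := Metric.isOpen_iff.mp hU.1 u hu
  obtain ⟨K, hK⟩ := hmin.exists_iterate_mem_le hTc (U := ball u (ρ / 2))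
    ⟨isOpen_ball, u, mem_ball_self (half_pos hρ)⟩
  obtain ⟨ε, hε, hmod⟩ := exists_dist_iterate_lt hTc K (half_pos hρ)
  obtain ⟨w, z, Q, hz⟩ := exists_simultaneously_close hTc hmin hns hpair (N + 1) ε hε
  obtain ⟨j, hj, hju⟩ := hK (T^[Q] w)
  refine hmin.exists_mem_STset hTc hU.1 (Q := j + Q) (w := w) (z := z) ?_ (fun i hi => ?_)
    (fun i hi => (hz i (Nat.lt_succ_iff.mpr hi)).1)
  · rw [Function.iterate_add_apply]
    exact hball (ball_subset_ball (by linarith) hju)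
  · rw [Function.iterate_add_apply]
    refine hball ?_
    have h₁ := hmod _ _ (hz i (Nat.lt_succ_iff.mpr hi)).2 j hj
    rw [mem_ball] at hju ⊢
    have h₂ := dist_triangle_left (T^[j] (T^[Q] (z i))) u (T^[j] (T^[Q] w))
    linarith
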